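/- Let m, n be positive integers with n ≥ 2m, let 0 ≤ s ≤ 2m−1 be an integer, and let φ be the fundamental solution of (−Δ)^m in ℝ^n, namely φ(x) = c|x|^{2m−n} if n > 2m and φ(x) = c ln(5/|x|) if n = 2m, with c = c(m,n) > 0. Define ψ(x,y) = φ(x−y) − Σ_{|β| ≤ s−1} ((−y)^β / β!) D^β φ(x) (the sum being empty when s = 0). Then there is a constant C > 0 such that ∫_{B_1} |ψ(x,y)| dx ≤ C |y|^s for every y with 0 < |y| ≤ 1. -/

import Mathlib

open MeasureTheory Metric Real Set
open scoped ENNReal NNReal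

noncomputable section

/-- First-order partial derivative in direction `i`. -/
def pderiv1 {n : ℕ} (i : Fin n) (f : EuclideanSpace ℝ (Fin n) → ℝ) :
    EuclideanSpace ℝ (Fin n) → ℝ :=
  fun x => fderiv ℝ f x (EuclideanSpace.single i 1)

/-- The Laplacian `Δf = ∑ ∂²f/∂xᵢ²`. -/
def lap {n : ℕ} (f : EuclideanSpace ℝ (Fin n) → ℝ) : EuclideanSpace ℝ (Fin n) → ℝ :=
  fun x => ∑ i, pderiv1 i (pderiv1 i f) x

/-- The negative Laplacian `-Δ`. -/
def nlap {n : ℕ} (f : EuclideanSpace ℝ (Fin n) → ℝ) : EuclideanSpace ℝ (Fin n) → ℝ :=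
  fun x => -(lap f x)

/-- `(-Δ)^m`, the m-th iterate of the negative Laplacian. -/
def nlapIter {n : ℕ} (m : ℕ) (f : EuclideanSpace ℝ (Fin n) → ℝ) :
    EuclideanSpace ℝ (Fin n) → ℝ :=
  nlap^[m] f

/-- `D^β`, the mixed partial derivative associated to a multi-index `β`. -/
def mderiv {n : ℕ} (β : Fin n → ℕ) (f : EuclideanSpace ℝ (Fin n) → ℝ) :
    EuclideanSpace ℝ (Fin n) → ℝ :=
  ((List.finRange n).foldr (fun i F => F ∘ (pderiv1 i)^[β i]) id) f

/-- The finset of multi-indices `β` with `|β| ≤ s`. -/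
def degLE (n s : ℕ) : Finset (Fin n → ℕ) :=
  (Fintype.piFinset fun _ : Fin n => Finset.range (s+1)).filter fun β => ∑ i, β i ≤ s

/-- The finset of multi-indices `β` with `|β| < s` (i.e. `|β| ≤ s - 1`; empty for `s = 0`). -/
def degLT (n s : ℕ) : Finset (Fin n → ℕ) :=
  (Fintype.piFinset fun _ : Fin n => Finset.range s).filter fun β => ∑ i, β i < s

/-- Fundamental-solution profile of `(-Δ)^m` on `ℝⁿ`:
`c‖x‖^{2m-n}` for `n > 2m` and `c ln(5/‖x‖)` for `n = 2m`. -/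
def fundSol (m n : ℕ) (c : ℝ) : EuclideanSpace ℝ (Fin n) → ℝ :=
  fun x => if n = 2*m then c * Real.log (5 / ‖x‖) else c * ‖x‖ ^ ((2*m : ℤ) - n)

/-- `ψ(x,y) = φ(x-y) - ∑_{|β| ≤ s-1} ((-y)^β/β!) D^β φ(x)`. -/
def psiFun (m n s : ℕ) (c : ℝ) (x y : EuclideanSpace ℝ (Fin n)) : ℝ :=
  fundSol m n c (x - y) -
    ∑ β ∈ degLT n s,
      ((∏ i, (-(y i)) ^ β i) / ∏ i, ((β i).factorial : ℝ)) * mderiv β (fundSol m n c) x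

/-- `N(x) = ∫_{|y| ≤ 1} ψ(x,y) f(y) dy`. -/
def NFun (m n s : ℕ) (c : ℝ) (f : EuclideanSpace ℝ (Fin n) → ℝ)
    (x : EuclideanSpace ℝ (Fin n)) : ℝ :=
  ∫ y in closedBall (0 : EuclideanSpace ℝ (Fin n)) 1, psiFun m n s c x y * f y

open scoped ContDiff

section Derivatives

variable {n : ℕ} {U : Set (EuclideanSpace ℝ (Fin n))} {f g : EuclideanSpace ℝ (Fin n) → ℝ}

lemma contDiffOn_pderiv1 (hU : IsOpen U) (hf : ContDiffOn ℝ ∞ f U) (i : Fin n) :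
    ContDiffOn ℝ ∞ (pderiv1 i f) U :=
  (hf.fderiv_of_isOpen hU le_rfl).clm_apply contDiffOn_const

lemma contDiffOn_pderiv1_iterate (hU : IsOpen U) (hf : ContDiffOn ℝ ∞ f U) (i : Fin n) (k : ℕ) :
    ContDiffOn ℝ ∞ ((pderiv1 i)^[k] f) U := by
  induction k generalizing f with
  | zero => exact hf
  | succ k ih => exact ih (contDiffOn_pderiv1 hU hf i)

lemma eqOn_pderiv1 (hU : IsOpen U) (h : EqOn f g U) (i : Fin n) :
    EqOn (pderiv1 i f) (pderiv1 i g) U := fun x hx => by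
  have : f =ᶠ[nhds x] g := h.eventuallyEq_of_mem (hU.mem_nhds hx)
  simp only [pderiv1, this.fderiv_eq]

lemma eqOn_pderiv1_iterate (hU : IsOpen U) (h : EqOn f g U) (i : Fin n) (k : ℕ) :
    EqOn ((pderiv1 i)^[k] f) ((pderiv1 i)^[k] g) U := by
  induction k generalizing f g with
  | zero => exact h
  | succ k ih => exact ih (eqOn_pderiv1 hU h i)

lemma eqOn_pderiv1_comm (hU : IsOpen U) (hf : ContDiffOn ℝ ∞ f U) (i j : Fin n) :
    EqOn (pderiv1 i (pderiv1 j f)) (pderiv1 j (pderiv1 i f)) U := fun x hx => by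
  have hfx : ContDiffAt ℝ ∞ f x := hf.contDiffAt (hU.mem_nhds hx)
  have hd : DifferentiableAt ℝ (fderiv ℝ f) x :=
    ((hf.fderiv_of_isOpen (m := ∞) hU le_rfl).contDiffAt (hU.mem_nhds hx)).differentiableAt
      (by simp)
  have hs : IsSymmSndFDerivAt ℝ f x :=
    hfx.isSymmSndFDerivAt (by
      rw [minSmoothness_of_isRCLikeNormedField]
      exact WithTop.coe_le_coe.2 (le_top : (2 : ℕ∞) ≤ ⊤))
  have key : ∀ a b : Fin n, pderiv1 a (pderiv1 b f) x =
      fderiv ℝ (fderiv ℝ f) x (EuclideanSpace.single a 1) (EuclideanSpace.single b 1) := by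
    intro a b
    change fderiv ℝ (fun z => fderiv ℝ f z (EuclideanSpace.single b 1)) x _ = _
    rw [fderiv_clm_apply hd (differentiableAt_const _)]
    simp
  rw [key, key]
  exact hs _ _

lemma eqOn_pderiv1_iterate_comm (hU : IsOpen U) (hf : ContDiffOn ℝ ∞ f U) (i j : Fin n) (k : ℕ) :
    EqOn (pderiv1 i ((pderiv1 j)^[k] f)) ((pderiv1 j)^[k] (pderiv1 i f)) U := by
  induction k generalizing f with
  | zero => exact fun _ _ => rfl
  | succ k ih =>
    exact (ih (contDiffOn_pderiv1 hU hf j)).trans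
      (eqOn_pderiv1_iterate hU (eqOn_pderiv1_comm hU hf i j) j k)

/-- The mixed partial derivative with orders `β`, over the directions in the list `L`. -/
def mderivList (L : List (Fin n)) (β : Fin n → ℕ) (f : EuclideanSpace ℝ (Fin n) → ℝ) :
    EuclideanSpace ℝ (Fin n) → ℝ :=
  (L.foldr (fun i F => F ∘ (pderiv1 i)^[β i]) id) f

lemma eqOn_mderivList (hU : IsOpen U) (h : EqOn f g U) (L : List (Fin n)) (β : Fin n → ℕ) :
    EqOn (mderivList L β f) (mderivList L β g) U := by
  induction L generalizing f g with
  | nil => exact h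
  | cons a L ih => exact ih (eqOn_pderiv1_iterate hU h a (β a))

lemma mderivList_congr {L : List (Fin n)} {β γ : Fin n → ℕ} (h : ∀ i ∈ L, β i = γ i) :
    mderivList L β f = mderivList L γ f := by
  induction L generalizing f with
  | nil => rfl
  | cons a L ih =>
    change mderivList L β ((pderiv1 a)^[β a] f) = mderivList L γ ((pderiv1 a)^[γ a] f)
    rw [h a (by simp), ih fun i hi => h i (by simp [hi])]

lemma eqOn_mderivList_add_single (hU : IsOpen U) (hf : ContDiffOn ℝ ∞ f U) {L : List (Fin n)}
    (hL : L.Nodup) (β : Fin n → ℕ) {i : Fin n} (hi : i ∈ L) :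
    EqOn (mderivList L (β + Pi.single i 1) f) (mderivList L β (pderiv1 i f)) U := by
  induction L generalizing f with
  | nil => simp at hi
  | cons a L ih =>
    rw [List.nodup_cons] at hL
    change EqOn (mderivList L (β + Pi.single i 1)
        ((pderiv1 a)^[(β + Pi.single i 1 : Fin n → ℕ) a] f))
      (mderivList L β ((pderiv1 a)^[β a] (pderiv1 i f))) U
    by_cases hia : i = a
    · subst hia
      rw [mderivList_congr (γ := β)]
      · simp only [Pi.add_apply, Pi.single_eq_same]
        exact fun _ _ => rfl
      · intro j hj
        have : j ≠ i := fun h => hL.1 (h ▸ hj)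
        simp [this]
    · have ha : (β + Pi.single i 1 : Fin n → ℕ) a = β a := by simp [Ne.symm hia]
      rw [ha]
      refine (ih (contDiffOn_pderiv1_iterate hU hf a (β a)) hL.2 ?_).trans ?_
      · simpa [hia] using hi
      · exact eqOn_mderivList hU (eqOn_pderiv1_iterate_comm hU hf i a (β a)) L β

lemma eqOn_mderiv_add_single (hU : IsOpen U) (hf : ContDiffOn ℝ ∞ f U) (β : Fin n → ℕ)
    (i : Fin n) : EqOn (mderiv (β + Pi.single i 1) f) (mderiv β (pderiv1 i f)) U :=
  eqOn_mderivList_add_single hU hf (List.nodup_finRange n) β (List.mem_finRange i)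

lemma mderiv_zero : mderiv (0 : Fin n → ℕ) f = f := by
  have : ∀ L : List (Fin n), mderivList L 0 f = f := fun L => by
    induction L with
    | nil => rfl
    | cons a L ih => exact ih
  exact this _

end Derivatives

section Taylor

variable {n : ℕ} {U : Set (EuclideanSpace ℝ (Fin n))} {f : EuclideanSpace ℝ (Fin n) → ℝ}

lemma mem_degLT {s : ℕ} {β : Fin n → ℕ} : β ∈ degLT n s ↔ ∑ i, β i < s := by
  simp only [degLT, Finset.mem_filter, Fintype.mem_piFinset, Finset.mem_range, and_iff_right_iff_imp]
  exact fun h i => (Finset.single_le_sum (fun _ _ => Nat.zero_le _) (Finset.mem_univ i)).trans_lt h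

lemma sum_add_single (β : Fin n → ℕ) (i : Fin n) :
    ∑ j, (β + Pi.single i 1 : Fin n → ℕ) j = ∑ j, β j + 1 := by
  simp [Finset.sum_add_distrib, Finset.sum_pi_single']

/-- The Taylor polynomial of `f` at `x` of degree less than `s`, evaluated at `v`. -/
def taylorPoly (s : ℕ) (f : EuclideanSpace ℝ (Fin n) → ℝ) (x v : EuclideanSpace ℝ (Fin n)) : ℝ :=
  ∑ β ∈ degLT n s, ((∏ i, v i ^ β i) / ∏ i, ((β i).factorial : ℝ)) * mderiv β f x

lemma taylorPoly_zero (x v : EuclideanSpace ℝ (Fin n)) : taylorPoly 0 f x v = 0 := by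
  simp [taylorPoly, degLT]

lemma taylorPoly_succ_zero (s : ℕ) (x : EuclideanSpace ℝ (Fin n)) :
    taylorPoly (s + 1) f x 0 = f x := by
  rw [taylorPoly, Finset.sum_eq_single 0]
  · simp [mderiv_zero]
  · intro β _ hβ
    obtain ⟨i, hi⟩ : ∃ i, β i ≠ 0 := Function.ne_iff.1 hβ
    rw [Finset.prod_eq_zero (Finset.mem_univ i) (by simp [hi])]
    simp
  · simp [mem_degLT]

lemma hasDerivAt_mul_pow_div_factorial (a t : ℝ) (k : ℕ) :
    HasDerivAt (fun t : ℝ => (t * a) ^ k / (k.factorial : ℝ))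
      (a * if k = 0 then 0 else (t * a) ^ (k - 1) / ((k - 1).factorial : ℝ)) t := by
  cases k with
  | zero => simpa using hasDerivAt_const t (1 : ℝ)
  | succ k =>
    have h := (((hasDerivAt_id t).mul_const a).fun_pow (k + 1)).div_const ((k + 1).factorial : ℝ)
    refine h.congr_deriv ?_
    have : ((k.factorial : ℕ) : ℝ) ≠ 0 := by positivity
    simp [Nat.factorial_succ]
    field_simp

lemma hasDerivAt_taylorPoly (hU : IsOpen U) (hf : ContDiffOn ℝ ∞ f U) (s : ℕ)
    {x : EuclideanSpace ℝ (Fin n)} (hx : x ∈ U) (v : EuclideanSpace ℝ (Fin n)) (t : ℝ) :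
    HasDerivAt (fun t : ℝ => taylorPoly (s + 1) f x (t • v))
      (∑ i, v i * taylorPoly s (pderiv1 i f) x (t • v)) t := by
  set D : Fin n → (Fin n → ℕ) → ℝ := fun i β =>
    (∏ j ∈ Finset.univ.erase i, (t * v j) ^ β j / ((β j).factorial : ℝ)) *
      if β i = 0 then 0 else (t * v i) ^ (β i - 1) / ((β i - 1).factorial : ℝ) with hD
  have h1 : HasDerivAt (fun t : ℝ => taylorPoly (s + 1) f x (t • v))
      (∑ β ∈ degLT n (s + 1), (∑ i, v i * D i β) * mderiv β f x) t := by
    simp only [taylorPoly, PiLp.smul_apply, smul_eq_mul, ← Finset.prod_div_distrib]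
    refine HasDerivAt.fun_sum fun β _ => HasDerivAt.mul_const ?_ _
    refine (HasDerivAt.fun_finsetProd (u := Finset.univ) fun i _ =>
      hasDerivAt_mul_pow_div_factorial (v i) t (β i)).congr_deriv ?_
    refine Finset.sum_congr rfl fun i _ => ?_
    simp only [hD, smul_eq_mul]
    ring
  refine h1.congr_deriv ?_
  simp only [Finset.sum_mul]
  rw [Finset.sum_comm]
  refine Finset.sum_congr rfl fun i _ => ?_
  simp only [mul_assoc, taylorPoly, Finset.mul_sum (degLT n s)]
  symm
  refine Finset.sum_of_injOn (fun γ => γ + Pi.single i 1) ?_ ?_ ?_ ?_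
  · exact fun a _ b _ h => add_right_cancel h
  · intro γ hγ
    simp only [SetLike.mem_coe, mem_degLT] at hγ ⊢
    rw [sum_add_single]
    lia
  · intro β hβ hβ'
    have : β i = 0 := by
      by_contra h
      refine hβ' ⟨β - Pi.single i 1, ?_, ?_⟩
      · rw [SetLike.mem_coe, mem_degLT]
        rw [mem_degLT] at hβ
        have h2 := sum_add_single (β - Pi.single i 1) i
        rw [tsub_add_cancel_of_le] at h2
        · lia
        · intro j
          by_cases hj : j = i
          · subst hj; simp; lia
          · simp [hj]
      · refine tsub_add_cancel_of_le fun j => ?_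
        by_cases hj : j = i
        · subst hj; simp; lia
        · simp [hj]
    simp [hD, this]
  · intro γ _
    rw [eqOn_mderiv_add_single hU hf γ i hx]
    congr 2
    simp only [hD, PiLp.smul_apply, smul_eq_mul, ← Finset.prod_div_distrib]
    rw [← Finset.prod_erase_mul _ _ (Finset.mem_univ i)]
    congr 1
    · refine Finset.prod_congr rfl fun j hj => ?_
      simp [Finset.ne_of_mem_erase hj]
    · simp

end Taylor
section Homogeneous

variable {n : ℕ} {f : EuclideanSpace ℝ (Fin n) → ℝ} {d : ℤ}

/-- `f` is smooth and positively homogeneous of degree `d` away from the origin. -/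
structure IsSmoothHomogeneous (d : ℤ) (f : EuclideanSpace ℝ (Fin n) → ℝ) : Prop where
  contDiffOn : ContDiffOn ℝ ∞ f {0}ᶜ
  map_smul : ∀ r : ℝ, 0 < r → ∀ x, x ≠ 0 → f (r • x) = r ^ d * f x

lemma IsSmoothHomogeneous.exists_bound (hf : IsSmoothHomogeneous d f) :
    ∃ C, 0 ≤ C ∧ ∀ x, x ≠ 0 → |f x| ≤ C * ‖x‖ ^ d := by
  obtain ⟨C, hC⟩ := (isCompact_sphere (0 : EuclideanSpace ℝ (Fin n)) 1).exists_bound_of_continuousOn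
    (hf.contDiffOn.continuousOn.mono fun x hx => ne_of_mem_sphere hx one_ne_zero)
  refine ⟨max C 0, le_max_right _ _, fun x hx => ?_⟩
  have hx' : 0 < ‖x‖ := norm_pos_iff.2 hx
  have h1 : ‖‖x‖⁻¹ • x‖ = 1 := by rw [norm_smul, norm_inv, norm_norm, inv_mul_cancel₀ hx'.ne']
  have h2 : f x = ‖x‖ ^ d * f (‖x‖⁻¹ • x) := by
    rw [← hf.map_smul _ hx' _ (norm_pos_iff.1 (by rw [h1]; exact one_pos)), smul_smul,
      mul_inv_cancel₀ hx'.ne', one_smul]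
  rw [h2, abs_mul, abs_of_pos (zpow_pos hx' d), mul_comm]
  gcongr
  exact (hC _ (by simpa using h1)).trans (le_max_left _ _)

lemma isSmoothHomogeneous_pderiv1_of_map_smul (hf : ContDiffOn ℝ ∞ f {0}ᶜ)
    (h : ∀ r : ℝ, 0 < r → ∃ k : ℝ, ∀ x, x ≠ 0 → f (r • x) = r ^ d * f x + k) (i : Fin n) :
    IsSmoothHomogeneous (d - 1) (pderiv1 i f) := by
  refine ⟨contDiffOn_pderiv1 isOpen_compl_singleton hf i, fun r hr x hx => ?_⟩
  obtain ⟨k, hk⟩ := h r hr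
  have h1 : (fun z => f (r • z)) =ᶠ[nhds x] fun z => r ^ d * f z + k :=
    Filter.eventually_of_mem (isOpen_compl_singleton.mem_nhds hx) hk
  have hd : DifferentiableAt ℝ f x :=
    (hf.contDiffAt (isOpen_compl_singleton.mem_nhds hx)).differentiableAt (by simp)
  have h2 := h1.fderiv_eq (𝕜 := ℝ)
  rw [fderiv_comp_smul, fderiv_add_const, fderiv_const_mul hd] at h2
  have h3 := congrArg (fun A => A (EuclideanSpace.single i 1)) h2
  simp only [smul_apply, smul_eq_mul] at h3
  rw [zpow_sub_one₀ hr.ne']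
  simp only [pderiv1]
  field_simp
  linarith

lemma IsSmoothHomogeneous.pderiv1 (hf : IsSmoothHomogeneous d f) (i : Fin n) :
    IsSmoothHomogeneous (d - 1) (pderiv1 i f) :=
  isSmoothHomogeneous_pderiv1_of_map_smul hf.contDiffOn
    (fun r hr => ⟨0, fun x hx => by rw [add_zero, hf.map_smul r hr x hx]⟩) i

lemma IsSmoothHomogeneous.pderiv1_iterate (hf : IsSmoothHomogeneous d f) (i : Fin n) (k : ℕ) :
    IsSmoothHomogeneous (d - k) ((_root_.pderiv1 i)^[k] f) := by
  induction k generalizing f d with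
  | zero => simpa using hf
  | succ k ih =>
    have := ih (hf.pderiv1 i)
    rwa [sub_sub, add_comm, ← Nat.cast_add_one] at this

lemma IsSmoothHomogeneous.mderiv (hf : IsSmoothHomogeneous d f) (β : Fin n → ℕ) :
    IsSmoothHomogeneous (d - ∑ i, (β i : ℤ)) (mderiv β f) := by
  have : ∀ L : List (Fin n), IsSmoothHomogeneous (d - (L.map fun i => (β i : ℤ)).sum)
      (mderivList L β f) := fun L => by
    induction L generalizing f d with
    | nil => simpa [mderivList] using hf
    | cons a L ih =>
      have := ih (hf.pderiv1_iterate a (β a))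
      rwa [sub_sub, ← List.sum_cons, ← List.map_cons (f := fun i => (β i : ℤ))] at this
  have h := this (List.finRange n)
  rwa [← List.ofFn_eq_map, List.sum_ofFn] at h

lemma exists_bound_mderiv (hf : ContDiffOn ℝ ∞ f {0}ᶜ)
    (h : ∀ i, IsSmoothHomogeneous (d - 1) (pderiv1 i f)) {β : Fin n → ℕ} (hβ : β ≠ 0) :
    ∃ C, 0 ≤ C ∧ ∀ x, x ≠ 0 → |mderiv β f x| ≤ C * ‖x‖ ^ (d - ((∑ i, β i : ℕ) : ℤ)) := by
  obtain ⟨i, hi⟩ : ∃ i, β i ≠ 0 := Function.ne_iff.1 hβ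
  have hβi : β - Pi.single i 1 + Pi.single i 1 = β := by
    refine tsub_add_cancel_of_le fun j => ?_
    by_cases hj : j = i
    · subst hj; simp; lia
    · simp [hj]
  obtain ⟨C, hC0, hC⟩ := ((h i).mderiv (β - Pi.single i 1)).exists_bound
  refine ⟨C, hC0, fun x hx => ?_⟩
  have h1 := eqOn_mderiv_add_single isOpen_compl_singleton hf (β - Pi.single i 1) i hx
  have h2 := sum_add_single (β - Pi.single i 1) i
  rw [hβi] at h1 h2
  rw [h1, h2]
  refine (hC x hx).trans_eq ?_
  congr 2
  push_cast
  ring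

lemma zpow_norm_add_le (hd : d ≤ 0) {x v : EuclideanSpace ℝ (Fin n)} (hx : x ≠ 0)
    (hv : 2 * ‖v‖ ≤ ‖x‖) : ‖x + v‖ ^ d ≤ 2 ^ (-d) * ‖x‖ ^ d := by
  obtain ⟨k, rfl⟩ : ∃ k : ℕ, d = -(k : ℤ) := ⟨(-d).toNat, by lia⟩
  have hx' : 0 < ‖x‖ := norm_pos_iff.2 hx
  have h1 : ‖x‖ / 2 ≤ ‖x + v‖ := by
    have := norm_sub_le (x + v) v
    rw [add_sub_cancel_right] at this
    linarith
  simp only [neg_neg, zpow_neg, zpow_natCast]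
  calc (‖x + v‖ ^ k)⁻¹ ≤ ((‖x‖ / 2) ^ k)⁻¹ := by gcongr
    _ = 2 ^ k * (‖x‖ ^ k)⁻¹ := by rw [div_pow, inv_div, div_eq_mul_inv]

lemma taylor_remainder_succ (hf : ContDiffOn ℝ ∞ f {0}ᶜ) (s : ℕ)
    (h : ∀ i, ∃ C, 0 ≤ C ∧ ∀ x v, x ≠ 0 → 2 * ‖v‖ ≤ ‖x‖ →
      |pderiv1 i f (x + v) - taylorPoly s (pderiv1 i f) x v| ≤
        C * ‖v‖ ^ s * ‖x‖ ^ (d - 1 - s)) :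
    ∃ C, 0 ≤ C ∧ ∀ x v, x ≠ 0 → 2 * ‖v‖ ≤ ‖x‖ →
      |f (x + v) - taylorPoly (s + 1) f x v| ≤
        C * ‖v‖ ^ (s + 1) * ‖x‖ ^ (d - (s + 1 : ℕ)) := by
  choose C hC0 hC using h
  refine ⟨∑ i, C i, Finset.sum_nonneg fun i _ => hC0 i, fun x v hx hv => ?_⟩
  have hx' : 0 < ‖x‖ := norm_pos_iff.2 hx
  have htv : ∀ t ∈ Icc (0 : ℝ) 1, ‖t • v‖ ≤ ‖v‖ := fun t ht => by
    rw [norm_smul, Real.norm_of_nonneg ht.1]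
    exact mul_le_of_le_one_left (norm_nonneg _) ht.2
  have hne : ∀ t ∈ Icc (0 : ℝ) 1, x + t • v ≠ 0 := fun t ht h0 => by
    have h1 : ‖x‖ = ‖t • v‖ := by rw [eq_neg_of_add_eq_zero_left h0, norm_neg]
    linarith [htv t ht]
  have hderiv : ∀ t ∈ Icc (0 : ℝ) 1, HasDerivAt
      (fun t : ℝ => f (x + t • v) - taylorPoly (s + 1) f x (t • v))
      (∑ i, v i * (pderiv1 i f (x + t • v) - taylorPoly s (pderiv1 i f) x (t • v))) t := by
    intro t ht
    have h1 : HasFDerivAt f (fderiv ℝ f (x + t • v)) (x + t • v) :=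
      ((hf.contDiffAt (isOpen_compl_singleton.mem_nhds (hne t ht))).differentiableAt
        (by simp)).hasFDerivAt
    have h2 : HasDerivAt (fun t : ℝ => x + t • v) v t := by
      simpa using ((hasDerivAt_id t).smul_const v).const_add x
    have h3 := (h1.comp_hasDerivAt t h2).sub
      (hasDerivAt_taylorPoly isOpen_compl_singleton hf s hx v t)
    refine h3.congr_deriv ?_
    have hv : v = ∑ i, v i • EuclideanSpace.single i (1 : ℝ) := by
      ext j
      simp [Pi.single_apply]
    have h4 : fderiv ℝ f (x + t • v) v = ∑ i, v i * pderiv1 i f (x + t • v) := by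
      conv_lhs => rw [hv, map_sum]
      simp [pderiv1, hv.symm]
    rw [h4, ← Finset.sum_sub_distrib]
    simp only [mul_sub]
  have hb := norm_image_sub_le_of_norm_deriv_le_segment_01'
    (C := (∑ i, C i) * ‖v‖ ^ (s + 1) * ‖x‖ ^ (d - (s + 1 : ℕ)))
    (fun t ht => (hderiv t ht).hasDerivWithinAt) fun t ht => by
      have ht' := Ico_subset_Icc_self ht
      have hz : 0 < ‖x‖ ^ (d - (s + 1 : ℕ)) := zpow_pos hx' _
      rw [Finset.sum_mul, Finset.sum_mul]
      refine (norm_sum_le _ _).trans (Finset.sum_le_sum fun i _ => ?_)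
      rw [norm_mul]
      have h1 := hC i x (t • v) hx (by linarith [htv t ht'])
      rw [sub_sub, add_comm (1 : ℤ), ← Nat.cast_add_one] at h1
      calc ‖v i‖ * ‖pderiv1 i f (x + t • v) - taylorPoly s (pderiv1 i f) x (t • v)‖
          ≤ ‖v‖ * (C i * ‖v‖ ^ s * ‖x‖ ^ (d - (s + 1 : ℕ))) := by
            refine mul_le_mul (PiLp.norm_apply_le v i) (h1.trans ?_) (norm_nonneg _) (norm_nonneg _)
            have := hC0 i
            have := htv t ht'
            gcongr
        _ = _ := by ring
  simpa [taylorPoly_succ_zero] using hb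

lemma IsSmoothHomogeneous.taylor_remainder (hf : IsSmoothHomogeneous d f) (hd : d ≤ 0) (s : ℕ) :
    ∃ C, 0 ≤ C ∧ ∀ x v, x ≠ 0 → 2 * ‖v‖ ≤ ‖x‖ →
      |f (x + v) - taylorPoly s f x v| ≤ C * ‖v‖ ^ s * ‖x‖ ^ (d - s) := by
  induction s generalizing f d with
  | zero =>
    obtain ⟨C, hC0, hC⟩ := hf.exists_bound
    refine ⟨C * 2 ^ (-d), by positivity, fun x v hx hv => ?_⟩
    have hne : x + v ≠ 0 := fun h0 => by
      have h1 : ‖x‖ = ‖v‖ := by rw [eq_neg_of_add_eq_zero_left h0, norm_neg]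
      linarith [norm_pos_iff.2 hx]
    rw [taylorPoly_zero, sub_zero, pow_zero, mul_one, Nat.cast_zero, sub_zero, mul_assoc]
    exact (hC _ hne).trans (mul_le_mul_of_nonneg_left (zpow_norm_add_le hd hx hv) hC0)
  | succ s ih =>
    exact taylor_remainder_succ hf.contDiffOn s fun i => ih (hf.pderiv1 i) (by lia)

lemma abs_prod_pow_div_factorial_le (y : EuclideanSpace ℝ (Fin n)) (β : Fin n → ℕ) :
    |(∏ i, y i ^ β i) / ∏ i, ((β i).factorial : ℝ)| ≤ ‖y‖ ^ ∑ i, β i := by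
  rw [← Finset.prod_div_distrib, Finset.abs_prod, ← Finset.prod_pow_eq_pow_sum]
  refine Finset.prod_le_prod (fun _ _ => abs_nonneg _) fun i _ => ?_
  have h1 : (1 : ℝ) ≤ ((β i).factorial : ℝ) := by exact_mod_cast (β i).factorial_pos
  rw [abs_div, abs_pow, abs_of_pos (one_pos.trans_le h1)]
  refine (div_le_self (by positivity) h1).trans ?_
  have := PiLp.norm_apply_le y i
  rw [Real.norm_eq_abs] at this
  gcongr

lemma pow_mul_zpow_le {a b : ℝ} (ha : 0 < a) (hab : a ≤ 2 * b) {j s : ℕ} (hj : j ≤ s) :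
    b ^ j * a ^ (d - j) ≤ 2 ^ s * b ^ s * a ^ (d - s) := by
  have hb : 0 < b := by linarith
  obtain ⟨k, rfl⟩ := Nat.exists_eq_add_of_le hj
  have h1 : a ^ (d - j) = a ^ (d - (j + k : ℕ)) * a ^ k := by
    rw [← zpow_natCast, ← zpow_add₀ ha.ne']
    congr 1
    push_cast
    ring
  have h2 : a ^ k ≤ 2 ^ k * b ^ k := by
    rw [← mul_pow]
    gcongr
  have h3 : (2 : ℝ) ^ k ≤ 2 ^ (j + k) := pow_le_pow_right₀ one_le_two (by lia)
  rw [h1]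
  calc b ^ j * (a ^ (d - (j + k : ℕ)) * a ^ k)
      ≤ b ^ j * (a ^ (d - (j + k : ℕ)) * (2 ^ (j + k) * b ^ k)) := by
        gcongr
        exact h2.trans (by gcongr)
    _ = _ := by ring

lemma taylorPoly_sub_le (hf : ContDiffOn ℝ ∞ f {0}ᶜ)
    (h : ∀ i, IsSmoothHomogeneous (d - 1) (pderiv1 i f)) (s : ℕ) :
    ∃ C, 0 ≤ C ∧ ∀ x v, x ≠ 0 → ‖x‖ ≤ 2 * ‖v‖ →
      |taylorPoly (s + 1) f x v - f x| ≤
        C * ‖v‖ ^ (s + 1) * ‖x‖ ^ (d - (s + 1 : ℕ)) := by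
  have hb : ∀ β : Fin n → ℕ, ∃ C, 0 ≤ C ∧ (β ≠ 0 → ∀ x, x ≠ 0 →
      |mderiv β f x| ≤ C * ‖x‖ ^ (d - ((∑ i, β i : ℕ) : ℤ))) := fun β => by
    by_cases hβ : β = 0
    · exact ⟨0, le_rfl, fun h => absurd hβ h⟩
    · obtain ⟨C, hC0, hC⟩ := exists_bound_mderiv hf h hβ
      exact ⟨C, hC0, fun _ => hC⟩
  choose C hC0 hC using hb
  refine ⟨(∑ β ∈ (degLT n (s + 1)).erase 0, C β) * 2 ^ (s + 1),
    mul_nonneg (Finset.sum_nonneg fun β _ => hC0 β) (by positivity), fun x v hx hxv => ?_⟩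
  have h0 : (0 : Fin n → ℕ) ∈ degLT n (s + 1) := by simp [mem_degLT]
  rw [taylorPoly, ← Finset.add_sum_erase _ _ h0]
  simp only [mderiv_zero, Pi.zero_apply, pow_zero, Nat.factorial_zero, Nat.cast_one,
    Finset.prod_const_one, div_one, one_mul, add_sub_cancel_left]
  rw [Finset.sum_mul, Finset.sum_mul, Finset.sum_mul]
  refine (Finset.abs_sum_le_sum_abs _ _).trans (Finset.sum_le_sum fun β hβ => ?_)
  rw [Finset.mem_erase, mem_degLT] at hβ
  rw [abs_mul]
  have h1 := pow_mul_zpow_le (d := d) (norm_pos_iff.2 hx) hxv hβ.2.le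
  calc _ ≤ ‖v‖ ^ (∑ i, β i) * (C β * ‖x‖ ^ (d - ((∑ i, β i : ℕ) : ℤ))) :=
        mul_le_mul (abs_prod_pow_div_factorial_le v β) (hC β hβ.1 x hx) (abs_nonneg _)
          (by positivity)
    _ = C β * (‖v‖ ^ (∑ i, β i) * ‖x‖ ^ (d - ((∑ i, β i : ℕ) : ℤ))) := by ring
    _ ≤ C β * (2 ^ (s + 1) * ‖v‖ ^ (s + 1) * ‖x‖ ^ (d - (s + 1 : ℕ))) :=
        mul_le_mul_of_nonneg_left h1 (hC0 β)
    _ = _ := by ring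

lemma taylor_remainder_le (hf : ContDiffOn ℝ ∞ f {0}ᶜ) (hd : d ≤ 0)
    (h : ∀ i, IsSmoothHomogeneous (d - 1) (pderiv1 i f)) (s : ℕ)
    (hnear : ∃ A, 0 ≤ A ∧ ∀ x v, x ≠ 0 → x + v ≠ 0 → ‖x‖ ≤ 2 * ‖v‖ →
      |f (x + v) - f x| ≤ A * ‖v‖ ^ (s + 1) *
        (‖x‖ ^ (d - (s + 1 : ℕ)) + ‖x + v‖ ^ (d - (s + 1 : ℕ)))) :
    ∃ C, 0 ≤ C ∧ ∀ x v, x ≠ 0 → x + v ≠ 0 →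
      |f (x + v) - taylorPoly (s + 1) f x v| ≤ C * ‖v‖ ^ (s + 1) *
        (‖x‖ ^ (d - (s + 1 : ℕ)) + ‖x + v‖ ^ (d - (s + 1 : ℕ))) := by
  obtain ⟨A, hA0, hA⟩ := hnear
  obtain ⟨B, hB0, hB⟩ := taylorPoly_sub_le hf h s
  obtain ⟨C, hC0, hC⟩ := taylor_remainder_succ (d := d) hf s fun i =>
    (h i).taylor_remainder (by lia) s
  refine ⟨A + B + C, by positivity, fun x v hx hxv => ?_⟩
  set P := ‖x‖ ^ (d - (s + 1 : ℕ))
  set Q := ‖x + v‖ ^ (d - (s + 1 : ℕ))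
  have hP : 0 ≤ P := by positivity
  have hQ : 0 ≤ Q := by positivity
  set w := ‖v‖ ^ (s + 1)
  have hw : 0 ≤ w := by positivity
  have hwP : 0 ≤ w * P := by positivity
  have hwQ : 0 ≤ w * Q := by positivity
  rcases le_total ‖x‖ (2 * ‖v‖) with hle | hle
  · have h1 := hA x v hx hxv hle
    have h2 := hB x v hx hle
    have h3 := abs_sub (f (x + v) - f x) (taylorPoly (s + 1) f x v - f x)
    rw [sub_sub_sub_cancel_right] at h3
    nlinarith [mul_nonneg hB0 hwQ, mul_nonneg hC0 hwP, mul_nonneg hC0 hwQ]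
  · have h1 := hC x v hx hle
    nlinarith [mul_nonneg hA0 hwP, mul_nonneg hA0 hwQ, mul_nonneg hB0 hwP, mul_nonneg hB0 hwQ,
      mul_nonneg hC0 hwQ]

end Homogeneous
section Integral

variable {n : ℕ}

lemma integrableOn_zpow_norm (hn : 0 < n) {e : ℤ} (he : -(n : ℤ) < e) (R : ℝ) :
    IntegrableOn (fun x : EuclideanSpace ℝ (Fin n) => ‖x‖ ^ e) (ball 0 R) := by
  have : Nonempty (Fin n) := ⟨⟨0, hn⟩⟩
  rw [integrableOn_fun_norm_addHaar volume (f := fun r : ℝ => r ^ e), finrank_euclideanSpace_fin]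
  have he' : -1 < ((n - 1 + e : ℤ) : ℝ) := by exact_mod_cast (by lia : -1 < (n - 1 + e : ℤ))
  have h := (intervalIntegral.intervalIntegrable_rpow' (a := 0) (b := max R 0) he').1
  refine (h.mono_set fun x hx => ⟨hx.1, hx.2.le.trans (le_max_left _ _)⟩).congr_fun
    (fun x hx => ?_) measurableSet_Ioo
  have hx0 : 0 < x := hx.1
  simp only [smul_eq_mul]
  rw [Real.rpow_intCast, zpow_add₀ hx0.ne', ← zpow_natCast, Nat.cast_sub hn, Nat.cast_one]

/-- A kernel bounded by `‖y‖ ^ s * (‖x‖ ^ e + ‖x - y‖ ^ e)` with `e > -n` integrates over the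
unit ball to at most a multiple of `‖y‖ ^ s`. -/
lemma lintegral_kernel_le (hn : 0 < n) {e : ℤ} (he : -(n : ℤ) < e) {s : ℕ}
    {F : EuclideanSpace ℝ (Fin n) → EuclideanSpace ℝ (Fin n) → ℝ}
    (hF : ∃ C, 0 ≤ C ∧ ∀ x y, ‖x‖ < 1 → ‖y‖ ≤ 1 → x ≠ 0 → x - y ≠ 0 →
      |F x y| ≤ C * ‖y‖ ^ s * (‖x‖ ^ e + ‖x - y‖ ^ e)) :
    ∃ C > (0 : ℝ), ∀ y : EuclideanSpace ℝ (Fin n), 0 < ‖y‖ → ‖y‖ ≤ 1 →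
      ∫⁻ x in ball (0 : EuclideanSpace ℝ (Fin n)) 1, ENNReal.ofReal |F x y|
        ≤ ENNReal.ofReal (C * ‖y‖ ^ s) := by
  have : Nonempty (Fin n) := ⟨⟨0, hn⟩⟩
  obtain ⟨C, hC0, hC⟩ := hF
  set I := ∫ x in ball (0 : EuclideanSpace ℝ (Fin n)) 2, ‖x‖ ^ e with hI
  have hI0 : 0 ≤ I := integral_nonneg fun x => by positivity
  have hIint := integrableOn_zpow_norm hn he 2
  have hIl : ∫⁻ x in ball (0 : EuclideanSpace ℝ (Fin n)) 2, ENNReal.ofReal (‖x‖ ^ e) =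
      ENNReal.ofReal I :=
    (ofReal_integral_eq_lintegral_ofReal hIint (ae_of_all _ fun x => by positivity)).symm
  have hmeas : Measurable fun x : EuclideanSpace ℝ (Fin n) => ENNReal.ofReal (‖x‖ ^ e) := by
    fun_prop
  refine ⟨C * (I + I) + 1, by positivity, fun y _ hy => ?_⟩
  have h1 : ∫⁻ x in ball (0 : EuclideanSpace ℝ (Fin n)) 1, ENNReal.ofReal (‖x‖ ^ e) ≤
      ENNReal.ofReal I := by
    rw [← hIl]
    exact lintegral_mono_set (ball_subset_ball one_le_two)
  have h2 : ∫⁻ x in ball (0 : EuclideanSpace ℝ (Fin n)) 1, ENNReal.ofReal (‖x - y‖ ^ e) ≤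
      ENNReal.ofReal I := by
    rw [← hIl, ← lintegral_indicator measurableSet_ball, ← lintegral_indicator measurableSet_ball,
      ← lintegral_sub_right_eq_self
        ((ball (0 : EuclideanSpace ℝ (Fin n)) 2).indicator fun x => ENNReal.ofReal (‖x‖ ^ e)) y]
    refine lintegral_mono fun x => ?_
    by_cases hx : x ∈ ball (0 : EuclideanSpace ℝ (Fin n)) 1
    · have hxy : x - y ∈ ball (0 : EuclideanSpace ℝ (Fin n)) 2 := by
        rw [mem_ball_zero_iff] at hx ⊢
        linarith [norm_sub_le x y]
      rw [indicator_of_mem hx, indicator_of_mem hxy]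
    · rw [indicator_of_notMem hx]
      exact zero_le
  have hae : ∀ᵐ x ∂(volume.restrict (ball (0 : EuclideanSpace ℝ (Fin n)) 1)),
      ENNReal.ofReal |F x y| ≤ ENNReal.ofReal (C * ‖y‖ ^ s) *
        (ENNReal.ofReal (‖x‖ ^ e) + ENNReal.ofReal (‖x - y‖ ^ e)) := by
    rw [ae_restrict_iff' measurableSet_ball]
    filter_upwards [Measure.ae_ne volume (0 : EuclideanSpace ℝ (Fin n)),
      Measure.ae_ne volume y] with x hx0 hxy hx
    rw [← ENNReal.ofReal_add (by positivity) (by positivity),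
      ← ENNReal.ofReal_mul (by positivity)]
    exact ENNReal.ofReal_le_ofReal
      (hC x y (mem_ball_zero_iff.1 hx) hy hx0 (sub_ne_zero.2 hxy))
  calc _ ≤ ∫⁻ x in ball (0 : EuclideanSpace ℝ (Fin n)) 1, ENNReal.ofReal (C * ‖y‖ ^ s) *
        (ENNReal.ofReal (‖x‖ ^ e) + ENNReal.ofReal (‖x - y‖ ^ e)) := lintegral_mono_ae hae
    _ ≤ ENNReal.ofReal (C * ‖y‖ ^ s) * (ENNReal.ofReal I + ENNReal.ofReal I) := by
        rw [lintegral_const_mul _ (by fun_prop), lintegral_add_left hmeas]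
        gcongr
    _ ≤ _ := by
        rw [← ENNReal.ofReal_add hI0 hI0, ← ENNReal.ofReal_mul (by positivity)]
        refine ENNReal.ofReal_le_ofReal ?_
        have : 0 ≤ ‖y‖ ^ s := by positivity
        nlinarith

end Integral

section FundamentalSolution

variable {m n : ℕ} {c : ℝ}

lemma psiFun_eq_taylorPoly (s : ℕ) (x y : EuclideanSpace ℝ (Fin n)) :
    psiFun m n s c x y =
      fundSol m n c (x + -y) - taylorPoly s (fundSol m n c) x (-y) := by
  rw [← sub_eq_add_neg]
  rfl

lemma contDiffOn_norm_compl_zero :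
    ContDiffOn ℝ ∞ (fun x : EuclideanSpace ℝ (Fin n) => ‖x‖) {0}ᶜ :=
  contDiffOn_id.norm ℝ fun _ hx => hx

lemma isSmoothHomogeneous_fundSol (hn : 2 * m < n) :
    IsSmoothHomogeneous ((2 * m : ℤ) - n) (fundSol m n c) := by
  have hφ : fundSol m n c = fun x => c * ‖x‖ ^ ((2 * m : ℤ) - n) := by
    funext x
    simp [fundSol, hn.ne']
  rw [hφ]
  refine ⟨?_, fun r hr x _ => ?_⟩
  · obtain ⟨k, hk⟩ : ∃ k : ℕ, (2 * m : ℤ) - n = -(k : ℤ) := ⟨n - 2 * m, by lia⟩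
    simp only [hk, zpow_neg, zpow_natCast]
    exact contDiffOn_const.mul ((contDiffOn_norm_compl_zero.pow k).inv fun x hx =>
      pow_ne_zero _ (norm_ne_zero_iff.2 hx))
  · rw [norm_smul, Real.norm_of_nonneg hr.le, mul_zpow]
    ring

lemma fundSol_log (hn : n = 2 * m) : fundSol m n c = fun x => c * Real.log (5 / ‖x‖) := by
  funext x
  simp [fundSol, hn]

lemma contDiffOn_fundSol_log (hn : n = 2 * m) : ContDiffOn ℝ ∞ (fundSol m n c) {0}ᶜ := by
  rw [fundSol_log hn]
  exact contDiffOn_const.mul ((contDiffOn_const.div contDiffOn_norm_compl_zero fun x hx =>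
    norm_ne_zero_iff.2 hx).log fun x hx => div_ne_zero (by norm_num) (norm_ne_zero_iff.2 hx))

lemma isSmoothHomogeneous_pderiv1_fundSol_log (hn : n = 2 * m) (i : Fin n) :
    IsSmoothHomogeneous (0 - 1) (pderiv1 i (fundSol m n c)) := by
  refine isSmoothHomogeneous_pderiv1_of_map_smul (contDiffOn_fundSol_log hn)
    (fun r hr => ⟨-(c * Real.log r), fun x hx => ?_⟩) i
  have hx' : ‖x‖ ≠ 0 := norm_ne_zero_iff.2 hx
  simp only [fundSol_log hn]
  rw [norm_smul, Real.norm_of_nonneg hr.le, Real.log_div (by norm_num) (by positivity),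
    Real.log_mul hr.ne' hx', Real.log_div (by norm_num) hx']
  simp only [zpow_zero]
  ring

lemma zpow_le_of_norm_le {a b : ℝ} (ha : 0 < a) (hab : a ≤ 3 * b) (d : ℤ) (s : ℕ) :
    a ^ d ≤ 3 ^ s * b ^ s * a ^ (d - s) := by
  have h1 : a ^ d = a ^ s * a ^ (d - s) := by
    rw [← zpow_natCast, ← zpow_add₀ ha.ne']
    congr 1
    ring
  rw [h1, ← mul_pow]
  gcongr

lemma log_div_le_zpow {a b w : ℝ} (ha : 0 < a) (hb : 0 < b) (haw : a ≤ 3 * w) (hbw : b ≤ 3 * w)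
    (s : ℕ) : Real.log (a / b) ≤ 3 ^ (s + 1) * w ^ (s + 1) * b ^ ((0 : ℤ) - (s + 1 : ℕ)) := by
  have h1 : 1 ≤ 3 * w / b := (one_le_div hb).2 hbw
  calc Real.log (a / b) ≤ a / b := (Real.log_le_sub_one_of_pos (by positivity)).trans (by linarith)
    _ ≤ 3 * w / b := by gcongr
    _ ≤ (3 * w / b) ^ (s + 1) := le_self_pow₀ h1 (by lia)
    _ = _ := by
      rw [zero_sub, zpow_neg, zpow_natCast, div_pow, mul_pow, div_eq_mul_inv]

lemma norm_add_le_of_norm_le {x v : EuclideanSpace ℝ (Fin n)} (h : ‖x‖ ≤ 2 * ‖v‖) :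
    ‖x + v‖ ≤ 3 * ‖v‖ := by
  linarith [norm_add_le x v]

lemma fundSol_log_sub_le (hn : n = 2 * m) (s : ℕ) (hc : 0 < c) :
    ∃ A, 0 ≤ A ∧ ∀ x v : EuclideanSpace ℝ (Fin n), x ≠ 0 → x + v ≠ 0 → ‖x‖ ≤ 2 * ‖v‖ →
      |fundSol m n c (x + v) - fundSol m n c x| ≤ A * ‖v‖ ^ (s + 1) *
        (‖x‖ ^ ((0 : ℤ) - (s + 1 : ℕ)) + ‖x + v‖ ^ ((0 : ℤ) - (s + 1 : ℕ))) := by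
  refine ⟨c * 3 ^ (s + 1), by positivity, fun x v hx hxv hle => ?_⟩
  have ha : 0 < ‖x‖ := norm_pos_iff.2 hx
  have hb : 0 < ‖x + v‖ := norm_pos_iff.2 hxv
  have hbv := norm_add_le_of_norm_le hle
  have hav : ‖x‖ ≤ 3 * ‖v‖ := by linarith [norm_nonneg v]
  have h1 := log_div_le_zpow ha hb hav hbv s
  have h2 := log_div_le_zpow hb ha hbv hav s
  have hP : 0 ≤ 3 ^ (s + 1) * ‖v‖ ^ (s + 1) * ‖x‖ ^ ((0 : ℤ) - (s + 1 : ℕ)) := by positivity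
  have hQ : 0 ≤ 3 ^ (s + 1) * ‖v‖ ^ (s + 1) * ‖x + v‖ ^ ((0 : ℤ) - (s + 1 : ℕ)) := by positivity
  have h3 : |Real.log (5 / ‖x + v‖) - Real.log (5 / ‖x‖)| ≤
      3 ^ (s + 1) * ‖v‖ ^ (s + 1) * ‖x‖ ^ ((0 : ℤ) - (s + 1 : ℕ)) +
      3 ^ (s + 1) * ‖v‖ ^ (s + 1) * ‖x + v‖ ^ ((0 : ℤ) - (s + 1 : ℕ)) := by
    rw [Real.log_div ha.ne' hb.ne'] at h1
    rw [Real.log_div hb.ne' ha.ne'] at h2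
    rw [Real.log_div (by norm_num) ha.ne', Real.log_div (by norm_num) hb.ne', abs_le]
    constructor <;> linarith
  simp only [fundSol_log hn]
  rw [← mul_sub, abs_mul, abs_of_pos hc]
  refine (mul_le_mul_of_nonneg_left h3 hc.le).trans_eq ?_
  ring

lemma IsSmoothHomogeneous.sub_le {f : EuclideanSpace ℝ (Fin n) → ℝ} {d : ℤ}
    (hf : IsSmoothHomogeneous d f) (s : ℕ) :
    ∃ A, 0 ≤ A ∧ ∀ x v : EuclideanSpace ℝ (Fin n), x ≠ 0 → x + v ≠ 0 → ‖x‖ ≤ 2 * ‖v‖ →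
      |f (x + v) - f x| ≤ A * ‖v‖ ^ s * (‖x‖ ^ (d - s) + ‖x + v‖ ^ (d - s)) := by
  obtain ⟨C, hC0, hC⟩ := hf.exists_bound
  refine ⟨C * 3 ^ s, by positivity, fun x v hx hxv hle => ?_⟩
  have hav : ‖x‖ ≤ 3 * ‖v‖ := by linarith [norm_nonneg v]
  have h1 := (hC x hx).trans (mul_le_mul_of_nonneg_left
    (zpow_le_of_norm_le (norm_pos_iff.2 hx) hav d s) hC0)
  have h2 := (hC _ hxv).trans (mul_le_mul_of_nonneg_left
    (zpow_le_of_norm_le (norm_pos_iff.2 hxv) (norm_add_le_of_norm_le hle) d s) hC0)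
  refine (abs_sub _ _).trans ((add_le_add h2 h1).trans_eq ?_)
  ring

lemma fundSol_log_le (hn : n = 2 * m) (hc : 0 < c) {z : EuclideanSpace ℝ (Fin n)} (hz : z ≠ 0)
    (hz2 : ‖z‖ ≤ 2) : |fundSol m n c z| ≤ c * 5 * ‖z‖ ^ (-1 : ℤ) := by
  have hz' : 0 < ‖z‖ := norm_pos_iff.2 hz
  simp only [fundSol_log hn]
  rw [abs_mul, abs_of_pos hc, mul_assoc, zpow_neg_one, ← div_eq_mul_inv,
    abs_of_nonneg (Real.log_nonneg ((one_le_div hz').2 (by linarith)))]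
  gcongr
  exact (Real.log_le_sub_one_of_pos (by positivity)).trans (by linarith)

end FundamentalSolution

/-- the integral bound `∫_{B_1} |ψ(x,y)| dx ≤ C |y|^s` for `0 < |y| ≤ 1`. -/
theorem stmt_6 (m n s : ℕ) (hm : 0 < m) (hn : 2*m ≤ n) (hs : s ≤ 2*m - 1)
    (c : ℝ) (hc : 0 < c) :
    ∃ C > (0 : ℝ), ∀ y : EuclideanSpace ℝ (Fin n), 0 < ‖y‖ → ‖y‖ ≤ 1 →
      ∫⁻ x in ball (0 : EuclideanSpace ℝ (Fin n)) 1, ENNReal.ofReal |psiFun m n s c x y|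
        ≤ ENNReal.ofReal (C * ‖y‖ ^ s) := by
  simp only [psiFun_eq_taylorPoly]
  have of_remainder : ∀ (d : ℤ) (s : ℕ), -(n : ℤ) < d - s →
      (∃ C, 0 ≤ C ∧ ∀ x v, x ≠ 0 → x + v ≠ 0 →
        |fundSol m n c (x + v) - taylorPoly s (fundSol m n c) x v| ≤
          C * ‖v‖ ^ s * (‖x‖ ^ (d - s) + ‖x + v‖ ^ (d - s))) →
      ∃ C > (0 : ℝ), ∀ y : EuclideanSpace ℝ (Fin n), 0 < ‖y‖ → ‖y‖ ≤ 1 →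
        ∫⁻ x in ball (0 : EuclideanSpace ℝ (Fin n)) 1,
          ENNReal.ofReal |fundSol m n c (x + -y) - taylorPoly s (fundSol m n c) x (-y)|
          ≤ ENNReal.ofReal (C * ‖y‖ ^ s) := by
    rintro d s he ⟨C, hC0, hC⟩
    refine lintegral_kernel_le (by lia) he ⟨C, hC0, fun x y _ _ hx hxy => ?_⟩
    rw [sub_eq_add_neg x y] at hxy ⊢
    simpa only [norm_neg] using hC x (-y) hx hxy
  rcases hn.lt_or_eq with hlt | heq
  · have hφ := isSmoothHomogeneous_fundSol (c := c) hlt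
    refine of_remainder _ s (by lia : -(n : ℤ) < (2 * m : ℤ) - n - s) ?_
    cases s with
    | zero =>
      obtain ⟨C, hC0, hC⟩ := hφ.exists_bound
      refine ⟨C, hC0, fun x v _ hxv => ?_⟩
      rw [taylorPoly_zero, sub_zero, pow_zero, mul_one, Nat.cast_zero, sub_zero]
      refine (hC _ hxv).trans (mul_le_mul_of_nonneg_left ?_ hC0)
      exact le_add_of_nonneg_left (by positivity)
    | succ s =>
      exact taylor_remainder_le hφ.contDiffOn (by lia) hφ.pderiv1 s (hφ.sub_le (s + 1))
  · cases s with
    | zero =>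
      refine lintegral_kernel_le (by lia) (e := -1) (by lia)
        ⟨c * 5, by positivity, fun x y hx1 hy1 _ hxy => ?_⟩
      rw [taylorPoly_zero, sub_zero, pow_zero, mul_one, ← sub_eq_add_neg]
      refine (fundSol_log_le heq.symm hc hxy (by linarith [norm_sub_le x y])).trans
        (mul_le_mul_of_nonneg_left ?_ (by positivity))
      exact le_add_of_nonneg_left (by positivity)
    | succ s =>
      exact of_remainder 0 (s + 1) (by lia) (taylor_remainder_le (contDiffOn_fundSol_log heq.symm)
        le_rfl (isSmoothHomogeneous_pderiv1_fundSol_log heq.symm) s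
        (fundSol_log_sub_le heq.symm s hc))

end
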